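/- Let t ≥ 2, let n be divisible by t, let S₁,…,S_t ⊆ U with |S_i| = n/t for all i, let x ∈ U and k ≥ 1, and let s be the stream listing each element of S₁ once, then each element of S₂ once, …, then each element of S_t once, followed by k copies of x. Then: (a) if x ∈ S_i for every i and every element of U other than x belongs to at most one of the sets, then F₂(s) = n + t² − t + k² + 2tk; (b) if x belongs to at most one of the sets, and apart from at most one element z ≠ x that may belong to all t sets every element of U belongs to at most one of the sets, then F₂(s) ≤ n + t² − t + k² + 2k. In particular, the value of F₂(s) in case (a) exceeds any value in case (b) by at least 2k(t−1); with k = ⌈t/ε⌉ this gap is at least t²/ε. -/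

import Mathlib

/-- The second frequency moment of a stream, viewed as a multiset over a finite universe. -/
def multisetF2 {U : Type*} [Fintype U] [DecidableEq U] (s : Multiset U) : ℕ :=
  ∑ x : U, (s.count x) ^ 2

theorem multisetF2_add_replicate {U : Type*} [Fintype U] [DecidableEq U]
    (s : Multiset U) (k : ℕ) (x : U) :
    multisetF2 (s + Multiset.replicate k x) = multisetF2 s + k ^ 2 + 2 * s.count x * k := by
  unfold multisetF2
  rw [← Finset.add_sum_erase _ _ (Finset.mem_univ x),
    ← Finset.add_sum_erase (f := fun y => s.count y ^ 2) _ (Finset.mem_univ x)]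
  have h : ∑ y ∈ Finset.univ.erase x, (s + Multiset.replicate k x).count y ^ 2
      = ∑ y ∈ Finset.univ.erase x, s.count y ^ 2 := by
    refine Finset.sum_congr rfl fun y hy => ?_
    simp [Multiset.count_replicate, (Finset.ne_of_mem_erase hy).symm]
  rw [h, Multiset.count_add, Multiset.count_replicate_self]
  ring

/-- If every element other than `z` occurs at most once, then `F₂` is determined by the length
of the stream and the multiplicity of `z`. -/
theorem multisetF2_add_count_of_count_le_one {U : Type*} [Fintype U] [DecidableEq U]
    (s : Multiset U) (z : U) (h : ∀ y, y ≠ z → s.count y ≤ 1) :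
    multisetF2 s + s.count z = s.card + s.count z ^ 2 := by
  unfold multisetF2
  rw [← Multiset.sum_count_eq_card (s := Finset.univ) (m := s) fun a _ => Finset.mem_univ a,
    ← Finset.add_sum_erase _ _ (Finset.mem_univ z),
    ← Finset.add_sum_erase (f := fun y => s.count y) _ (Finset.mem_univ z)]
  have h' : ∑ y ∈ Finset.univ.erase z, s.count y ^ 2 = ∑ y ∈ Finset.univ.erase z, s.count y := by
    refine Finset.sum_congr rfl fun y hy => ?_
    have := h y (Finset.ne_of_mem_erase hy)
    interval_cases s.count y <;> rfl
  rw [h']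
  ring

theorem count_sum_val {U ι : Type*} [DecidableEq U] [Fintype ι] (S : ι → Finset U) (y : U) :
    (∑ i, (S i).val).count y = (Finset.univ.filter fun i => y ∈ S i).card := by
  rw [Multiset.count_sum', Finset.card_filter]
  exact Finset.sum_congr rfl fun i _ => Multiset.count_eq_of_nodup (S i).nodup

theorem count_sum_val_le_one {U ι : Type*} [DecidableEq U] [Fintype ι] (S : ι → Finset U) (y : U)
    (h : ∀ i j, i ≠ j → y ∈ S i → y ∉ S j) : (∑ i, (S i).val).count y ≤ 1 := by
  rw [count_sum_val, Finset.card_le_one]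
  intro i hi j hj
  by_contra hij
  exact h i j hij (Finset.mem_filter.mp hi).2 (Finset.mem_filter.mp hj).2

/-- the F₂ values of the stream encoding an Exam Disjointness instance,
in the `Yes' case (a), the `No' case (b), and the resulting gap. -/
theorem stmt9 {U : Type} [Fintype U] [DecidableEq U]
    (t n k : ℕ) (ht : 2 ≤ t) (hdvd : t ∣ n) (hk : 1 ≤ k)
    (S : Fin t → Finset U) (hcard : ∀ i, (S i).card = n / t) (x : U) :
    -- (a)
    (((∀ i, x ∈ S i) ∧ (∀ y : U, y ≠ x → ∀ i j, i ≠ j → y ∈ S i → y ∉ S j)) →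
      multisetF2 ((∑ i : Fin t, (S i).val) + Multiset.replicate k x)
        = n + t ^ 2 - t + k ^ 2 + 2 * t * k)
    ∧
    -- (b)
    (((∀ i j, i ≠ j → x ∈ S i → x ∉ S j) ∧
        (∃ z : U, z ≠ x ∧ ∀ y : U, y ≠ z → ∀ i j, i ≠ j → y ∈ S i → y ∉ S j)) →
      multisetF2 ((∑ i : Fin t, (S i).val) + Multiset.replicate k x)
        ≤ n + t ^ 2 - t + k ^ 2 + 2 * k)
    ∧
    -- the gap between case (a) and the largest possible value in case (b)
    ((n + t ^ 2 - t + k ^ 2 + 2 * t * k) - (n + t ^ 2 - t + k ^ 2 + 2 * k)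
        = 2 * k * (t - 1))
    ∧
    -- with k = ⌈t/ε⌉ the gap is at least t²/ε
    (∀ ε : ℝ, 0 < ε → k = ⌈(t : ℝ) / ε⌉₊ →
        (t : ℝ) ^ 2 / ε ≤ 2 * (k : ℝ) * ((t : ℝ) - 1)) := by
  have hsize : (∑ i : Fin t, (S i).val).card = n := by
    rw [Multiset.card_sum]
    simp [hcard, Nat.mul_div_cancel' hdvd]
  have htt : t ≤ t ^ 2 := Nat.le_self_pow two_ne_zero t
  refine ⟨?_, ?_, ?_, ?_⟩
  · rintro ⟨hx, hy⟩
    have hct : (∑ i : Fin t, (S i).val).count x = t := by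
      rw [count_sum_val]
      simp [hx]
    have h := multisetF2_add_count_of_count_le_one _ x
      fun y hyx => count_sum_val_le_one S y (hy y hyx)
    rw [multisetF2_add_replicate]
    rw [hct, hsize] at h
    rw [hct]
    omega
  · rintro ⟨hx, z, -, hy⟩
    have hcx := count_sum_val_le_one S x hx
    have hcz : (∑ i : Fin t, (S i).val).count z ≤ t := by
      rw [count_sum_val]
      exact (Finset.card_le_univ _).trans_eq (Fintype.card_fin t)
    have h := multisetF2_add_count_of_count_le_one _ z
      fun y hyz => count_sum_val_le_one S y (hy y hyz)
    rw [multisetF2_add_replicate]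
    rw [hsize] at h
    have hk' : 2 * (∑ i : Fin t, (S i).val).count x * k ≤ 2 * k := by nlinarith
    generalize (∑ i : Fin t, (S i).val).count z = c at *
    have hc : c ^ 2 + t ≤ t ^ 2 + c := by
      obtain ⟨d, rfl⟩ := Nat.exists_eq_add_of_le hcz
      nlinarith [Nat.le_self_pow two_ne_zero d, Nat.zero_le (c * d)]
    omega
  · rw [Nat.add_sub_add_left, Nat.mul_sub, mul_one, mul_right_comm]
  · intro ε _ hkε
    have hle : (t : ℝ) / ε ≤ k := hkε ▸ Nat.le_ceil _
    have ht' : (2 : ℝ) ≤ t := by exact_mod_cast ht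
    have hk0 : (0 : ℝ) ≤ k := k.cast_nonneg
    calc (t : ℝ) ^ 2 / ε = t / ε * t := by ring
      _ ≤ k * t := by gcongr
      _ ≤ 2 * k * (t - 1) := by nlinarith
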